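/- arXiv:1111.3603 — 5 statements merged into one kernel-verified Lean document; each statement's English description precedes it below -/
import Mathlib

section
/- For all natural numbers n, m ≥ 0, the convolution of Schreier families satisfies 𝒮ₙ * 𝒮ₘ = 𝒮_{n+m}. -/
/-- The successor operation for Schreier families: `F` belongs to the successor of `S`
if `F` is empty or `F = F₁ ∪ ⋯ ∪ F_k` with `F₁ < ⋯ < F_k`, each `F_j ∈ S`,
and `k ≤ min F₁`. -/
def SchreierSucc (S : Set (Finset ℕ)) : Set (Finset ℕ) :=
  {F | F = ∅ ∨ ∃ (k : ℕ) (hk : 0 < k) (G : Fin k → Finset ℕ),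
    (∀ i, G i ∈ S) ∧ (∀ i, (G i).Nonempty) ∧
    (∀ i j : Fin k, i < j → ∀ a ∈ G i, ∀ b ∈ G j, a < b) ∧
    (∀ a ∈ G ⟨0, hk⟩, k ≤ a) ∧
    F = Finset.univ.biUnion G}

/-- The Schreier families `𝒮ₙ`, as families of finite subsets of the positive integers:
`𝒮₀` consists of the empty set and the singletons of positive integers,
`𝒮₁ = {F : #F ≤ min F}` (together with the empty set), and
`𝒮ₙ₊₁` is obtained from `𝒮ₙ` by the successor operation. -/
def Schreier : ℕ → Set (Finset ℕ)
  | 0 => {F | F = ∅ ∨ ∃ n : ℕ, 0 < n ∧ F = {n}}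
  | 1 => {F | ∀ a ∈ F, F.card ≤ a}
  | n + 2 => SchreierSucc (Schreier (n + 1))

/-- The convolution `𝒮ₙ * 𝒮ₘ`: all sets `F = F₁ ∪ ⋯ ∪ F_k` with `F₁ < ⋯ < F_k`,
each `F_j ∈ 𝒮ₘ`, and `{min F_j : j = 1,…,k} ∈ 𝒮ₙ`, together with the empty set.
(Here `μ i` witnesses the minimum of `F_i`.) -/
def SchreierConv (n m : ℕ) : Set (Finset ℕ) :=
  {F | F = ∅ ∨ ∃ (k : ℕ) (_ : 0 < k) (G : Fin k → Finset ℕ) (μ : Fin k → ℕ),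
    (∀ i, G i ∈ Schreier m) ∧ (∀ i, (G i).Nonempty) ∧
    (∀ i j : Fin k, i < j → ∀ a ∈ G i, ∀ b ∈ G j, a < b) ∧
    (∀ i, μ i ∈ G i ∧ ∀ a ∈ G i, μ i ≤ a) ∧
    Finset.image μ Finset.univ ∈ Schreier n ∧
    F = Finset.univ.biUnion G}

/-- Block decompositions of `F`, coded by the map sending a point to the minimum of its block. -/
def SBlk (F : Finset ℕ) (c : ℕ → ℕ) : Prop :=
  (∀ a ∈ F, ∀ b ∈ F, a ≤ b → c a ≤ c b) ∧ (∀ a ∈ F, c a ∈ F) ∧ (∀ a ∈ F, c a ≤ a) ∧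
    (∀ a ∈ F, c (c a) = c a)

/-- Generic convolution of families. -/
def SStar (A B : Set (Finset ℕ)) : Set (Finset ℕ) :=
  {F | ∃ c : ℕ → ℕ, SBlk F c ∧ (∀ b ∈ F, F.filter (fun a => c a = c b) ∈ B) ∧ F.image c ∈ A}

theorem SStar_assoc (A B C : Set (Finset ℕ)) :
    SStar (SStar A B) C = SStar A (SStar B C) := by
  ext F
  constructor
  · rintro ⟨c, ⟨hm, hF, hle, hid⟩, hC, d, ⟨dm, dF, dle, did⟩, dB, dA⟩
    have hM : ∀ a ∈ F, c a ∈ F.image c := fun a ha => Finset.mem_image_of_mem c ha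
    have hMF : ∀ x ∈ F.image c, x ∈ F ∧ c x = x := by
      intro x hx
      obtain ⟨a, ha, rfl⟩ := Finset.mem_image.1 hx
      exact ⟨hF a ha, hid a ha⟩
    refine ⟨fun a => d (c a), ⟨?_, ?_, ?_, ?_⟩, ?_, ?_⟩
    · exact fun a ha b hb hab => dm _ (hM a ha) _ (hM b hb) (hm a ha b hb hab)
    · exact fun a ha => (hMF _ (dF _ (hM a ha))).1
    · exact fun a ha => (dle _ (hM a ha)).trans (hle a ha)
    · intro a ha
      simp only [(hMF _ (dF _ (hM a ha))).2, did _ (hM a ha)]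
    · intro b hb
      refine ⟨c, ⟨?_, ?_, ?_, ?_⟩, ?_, ?_⟩
      · intro x hx y hy
        exact hm x (Finset.mem_filter.1 hx).1 y (Finset.mem_filter.1 hy).1
      · intro x hx
        obtain ⟨h1, h2⟩ := Finset.mem_filter.1 hx
        exact Finset.mem_filter.2 ⟨hF x h1, by beta_reduce; rw [hid x h1]; exact h2⟩
      · exact fun x hx => hle x (Finset.mem_filter.1 hx).1
      · exact fun x hx => hid x (Finset.mem_filter.1 hx).1
      · intro x hx
        obtain ⟨h1, h2⟩ := Finset.mem_filter.1 hx
        convert hC x h1 using 1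
        ext y
        simp only [Finset.mem_filter]
        constructor
        · rintro ⟨⟨h3, -⟩, h4⟩
          exact ⟨h3, h4⟩
        · rintro ⟨h3, h4⟩
          exact ⟨⟨h3, by rw [h4]; exact h2⟩, h4⟩
      · convert dB (c b) (hM b hb) using 1
        ext y
        simp only [Finset.mem_filter, Finset.mem_image]
        constructor
        · rintro ⟨x, ⟨h1, h2⟩, rfl⟩
          exact ⟨⟨x, h1, rfl⟩, h2⟩
        · rintro ⟨⟨x, h1, rfl⟩, h2⟩
          exact ⟨x, ⟨h1, h2⟩, rfl⟩
    · rw [Finset.image_image] at dA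
      exact dA
  · rintro ⟨e, ⟨em, eF, ele, eid⟩, hBC, hA⟩
    have key : ∀ v : ℕ, ∃ c : ℕ → ℕ, ∀ b ∈ F, e b = v →
        SBlk (F.filter (fun a => e a = e b)) c ∧
        (∀ x ∈ F.filter (fun a => e a = e b),
          (F.filter (fun a => e a = e b)).filter (fun a => c a = c x) ∈ C) ∧
        (F.filter (fun a => e a = e b)).image c ∈ B := by
      intro v
      by_cases h : ∃ b ∈ F, e b = v
      · obtain ⟨b, hb, rfl⟩ := h
        obtain ⟨c, h1, h2, h3⟩ := hBC b hb
        refine ⟨c, fun b' _ h => ?_⟩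
        rw [h]
        exact ⟨h1, h2, h3⟩
      · exact ⟨id, fun b hb hv => absurd ⟨b, hb, hv⟩ h⟩
    choose c0 hc0 using key
    have hself : ∀ a ∈ F, a ∈ F.filter (fun x => e x = e a) :=
      fun a ha => Finset.mem_filter.2 ⟨ha, rfl⟩
    obtain ⟨c, hc⟩ : ∃ c : ℕ → ℕ, ∀ a, c a = c0 (e a) a := ⟨fun a => c0 (e a) a, fun _ => rfl⟩
    have cF : ∀ a ∈ F, c a ∈ F ∧ e (c a) = e a := by
      intro a ha
      have := (hc0 (e a) a ha rfl).1.2.1 a (hself a ha)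
      rw [← hc] at this
      exact Finset.mem_filter.1 this
    have cle : ∀ a ∈ F, c a ≤ a := by
      intro a ha
      rw [hc]
      exact (hc0 (e a) a ha rfl).1.2.2.1 a (hself a ha)
    have cid : ∀ a ∈ F, c (c a) = c a := by
      intro a ha
      rw [hc (c a), (cF a ha).2, hc a]
      exact (hc0 (e a) a ha rfl).1.2.2.2 a (hself a ha)
    have cm : ∀ a ∈ F, ∀ b ∈ F, a ≤ b → c a ≤ c b := by
      intro a ha b hb hab
      by_cases h : e a = e b
      · rw [hc a, hc b, h]
        exact (hc0 (e b) b hb rfl).1.1 a (Finset.mem_filter.2 ⟨ha, h⟩) b (hself b hb) hab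
      · by_contra hcon
        have h1 := em (c b) (cF b hb).1 (c a) (cF a ha).1 (by omega)
        rw [(cF a ha).2, (cF b hb).2] at h1
        exact h (le_antisymm (em a ha b hb hab) h1)
    have ce : ∀ a ∈ F, c (e a) = e a := by
      intro a ha
      apply le_antisymm (cle _ (eF a ha))
      have h1 := ele _ (cF _ (eF a ha)).1
      rw [(cF _ (eF a ha)).2, eid a ha] at h1
      exact h1
    have hMF : ∀ x ∈ F.image c, x ∈ F := by
      intro x hx
      obtain ⟨a, ha, rfl⟩ := Finset.mem_image.1 hx
      exact (cF a ha).1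
    refine ⟨c, ⟨cm, fun a ha => (cF a ha).1, cle, cid⟩, ?_, e, ⟨?_, ?_, ?_, ?_⟩, ?_, ?_⟩
    · intro b hb
      convert (hc0 (e b) b hb rfl).2.1 b (hself b hb) using 1
      ext y
      simp only [Finset.mem_filter]
      constructor
      · rintro ⟨h1, h2⟩
        have h3 : e y = e b := by rw [← (cF y h1).2, h2, (cF b hb).2]
        refine ⟨⟨h1, h3⟩, ?_⟩
        rw [hc, hc, h3] at h2
        exact h2
      · rintro ⟨⟨h1, h2⟩, h3⟩
        exact ⟨h1, by rw [hc, hc, h2]; exact h3⟩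
    · exact fun a ha b hb => em a (hMF a ha) b (hMF b hb)
    · exact fun a ha => Finset.mem_image.2 ⟨e a, eF a (hMF a ha), ce a (hMF a ha)⟩
    · exact fun a ha => ele a (hMF a ha)
    · exact fun a ha => eid a (hMF a ha)
    · intro b hb
      convert (hc0 (e b) b (hMF b hb) rfl).2.2 using 1
      ext y
      simp only [Finset.mem_filter, Finset.mem_image]
      constructor
      · rintro ⟨⟨x, h1, rfl⟩, h2⟩
        rw [(cF x h1).2] at h2
        exact ⟨x, ⟨h1, h2⟩, by rw [hc, h2]⟩
      · rintro ⟨x, ⟨h1, h2⟩, rfl⟩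
        have h3 : c0 (e b) x = c x := by rw [hc, h2]
        rw [h3]
        exact ⟨⟨x, h1, rfl⟩, by rw [(cF x h1).2, h2]⟩
    · convert hA using 1
      ext y
      simp only [Finset.mem_image]
      constructor
      · rintro ⟨_, ⟨x, h1, rfl⟩, rfl⟩
        exact ⟨x, h1, (cF x h1).2.symm⟩
      · rintro ⟨x, h1, rfl⟩
        exact ⟨c x, ⟨x, h1, rfl⟩, (cF x h1).2⟩

theorem SStar_of_fin {A B : Set (Finset ℕ)} {k : ℕ} {G : Fin k → Finset ℕ} {μ : Fin k → ℕ}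
    (hG : ∀ i, G i ∈ B)
    (hlt : ∀ i j : Fin k, i < j → ∀ a ∈ G i, ∀ b ∈ G j, a < b)
    (hμ : ∀ i, μ i ∈ G i ∧ ∀ a ∈ G i, μ i ≤ a)
    (hA : Finset.image μ Finset.univ ∈ A) : Finset.univ.biUnion G ∈ SStar A B := by
  have huniq : ∀ i j a, a ∈ G i → a ∈ G j → i = j := by
    intro i j a hi hj
    rcases lt_trichotomy i j with h | h | h
    · exact absurd (hlt i j h a hi a hj) (lt_irrefl _)
    · exact h
    · exact absurd (hlt j i h a hj a hi) (lt_irrefl _)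
  have key : ∀ a, ∃ v, ∀ i, a ∈ G i → v = μ i := by
    intro a
    by_cases h : ∃ i, a ∈ G i
    · obtain ⟨i, hi⟩ := h
      exact ⟨μ i, fun j hj => by rw [huniq i j a hi hj]⟩
    · exact ⟨0, fun i hi => absurd ⟨i, hi⟩ h⟩
  choose c hc using key
  have hmem : ∀ a, a ∈ Finset.univ.biUnion G ↔ ∃ i, a ∈ G i := by simp
  have hinj : ∀ i j, μ i = μ j → i = j := fun i j h =>
    huniq i j (μ i) (hμ i).1 (h ▸ (hμ j).1)
  refine ⟨c, ⟨?_, ?_, ?_, ?_⟩, ?_, ?_⟩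
  · intro a ha b hb hab
    obtain ⟨i, hi⟩ := (hmem a).1 ha
    obtain ⟨j, hj⟩ := (hmem b).1 hb
    rw [hc a i hi, hc b j hj]
    rcases lt_trichotomy i j with h | h | h
    · exact (hlt i j h _ (hμ i).1 _ (hμ j).1).le
    · rw [h]
    · exact absurd (hlt j i h b hj a hi) (by omega)
  · intro a ha
    obtain ⟨i, hi⟩ := (hmem a).1 ha
    rw [hc a i hi]
    exact (hmem _).2 ⟨i, (hμ i).1⟩
  · intro a ha
    obtain ⟨i, hi⟩ := (hmem a).1 ha
    rw [hc a i hi]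
    exact (hμ i).2 a hi
  · intro a ha
    obtain ⟨i, hi⟩ := (hmem a).1 ha
    rw [hc a i hi]
    exact hc _ i (hμ i).1
  · intro b hb
    obtain ⟨i, hi⟩ := (hmem b).1 hb
    convert hG i using 1
    ext y
    rw [Finset.mem_filter, hmem, hc b i hi]
    constructor
    · rintro ⟨⟨j, hj⟩, h⟩
      rw [hc y j hj] at h
      rw [← hinj _ _ h]
      exact hj
    · exact fun h => ⟨⟨i, h⟩, hc y i h⟩
  · convert hA using 1
    ext y
    simp only [Finset.mem_image, hmem, Finset.mem_univ, true_and]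
    constructor
    · rintro ⟨a, ⟨i, hi⟩, rfl⟩
      exact ⟨i, (hc a i hi).symm⟩
    · rintro ⟨i, rfl⟩
      exact ⟨μ i, ⟨i, (hμ i).1⟩, hc _ i (hμ i).1⟩

theorem SStar_to_fin {A B : Set (Finset ℕ)} {F : Finset ℕ} (hF : F ∈ SStar A B)
    (hne : F.Nonempty) : ∃ (k : ℕ) (_ : 0 < k) (G : Fin k → Finset ℕ) (μ : Fin k → ℕ),
    (∀ i, G i ∈ B) ∧ (∀ i, (G i).Nonempty) ∧
    (∀ i j : Fin k, i < j → ∀ a ∈ G i, ∀ b ∈ G j, a < b) ∧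
    (∀ i, μ i ∈ G i ∧ ∀ a ∈ G i, μ i ≤ a) ∧
    Finset.image μ Finset.univ ∈ A ∧
    F = Finset.univ.biUnion G := by
  obtain ⟨c, ⟨cm, cF, cle, cid⟩, hB, hA⟩ := hF
  have hμ := (F.image c).range_orderEmbOfFin rfl
  have hmono := ((F.image c).orderEmbOfFin rfl).strictMono
  obtain ⟨μ, hμdef⟩ : ∃ μ : Fin (F.image c).card → ℕ, ∀ i, μ i = (F.image c).orderEmbOfFin rfl i :=
    ⟨_, fun _ => rfl⟩
  have hr : ∀ x, x ∈ F.image c ↔ ∃ i, μ i = x := by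
    intro x
    simp only [hμdef]
    rw [← Finset.mem_coe, ← hμ]
    rfl
  have hfix : ∀ i, μ i ∈ F ∧ c (μ i) = μ i := by
    intro i
    obtain ⟨a, ha, h⟩ := Finset.mem_image.1 ((hr (μ i)).2 ⟨i, rfl⟩)
    rw [← h]
    exact ⟨cF a ha, cid a ha⟩
  have hself : ∀ i, μ i ∈ F.filter (fun a => c a = μ i) := fun i =>
    Finset.mem_filter.2 (hfix i)
  refine ⟨(F.image c).card, Finset.card_pos.2 (hne.image c),
    fun i => F.filter (fun a => c a = μ i), μ, ?_, ?_, ?_, ?_, ?_, ?_⟩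
  · intro i
    have := hB (μ i) (hfix i).1
    rwa [(hfix i).2] at this
  · exact fun i => ⟨_, hself i⟩
  · intro i j hij a ha b hb
    obtain ⟨ha, ha'⟩ := Finset.mem_filter.1 ha
    obtain ⟨hb, hb'⟩ := Finset.mem_filter.1 hb
    by_contra h
    have h1 := cm b hb a ha (by omega)
    have h2 : μ i < μ j := by rw [hμdef, hμdef]; exact hmono hij
    omega
  · refine fun i => ⟨hself i, fun a ha => ?_⟩
    obtain ⟨ha, ha'⟩ := Finset.mem_filter.1 ha
    rw [← ha']
    exact cle a ha
  · convert hA using 1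
    ext y
    rw [hr]
    simp
  · ext y
    simp only [Finset.mem_biUnion, Finset.mem_univ, true_and, Finset.mem_filter]
    constructor
    · intro hy
      obtain ⟨i, hi⟩ := (hr (c y)).1 (Finset.mem_image_of_mem c hy)
      exact ⟨i, hy, hi.symm⟩
    · rintro ⟨i, h, -⟩
      exact h

theorem SStar_empty {A B : Set (Finset ℕ)} (hA : ∅ ∈ A) : ∅ ∈ SStar A B :=
  ⟨id, by simp [SBlk], by simp, by simpa using hA⟩

theorem Schreier_empty (n : ℕ) : ∅ ∈ Schreier n := by
  rcases n with _ | _ | n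
  · simp [Schreier]
  · simp [Schreier]
  · exact Or.inl rfl

theorem SchreierConv_eq (n m : ℕ) : SchreierConv n m = SStar (Schreier n) (Schreier m) := by
  ext F
  constructor
  · rintro (rfl | ⟨k, hk, G, μ, h1, h2, h3, h4, h5, rfl⟩)
    · exact SStar_empty (Schreier_empty n)
    · exact SStar_of_fin h1 h3 h4 h5
  · intro h
    rcases F.eq_empty_or_nonempty with rfl | hne
    · exact Or.inl rfl
    · exact Or.inr (SStar_to_fin h hne)

theorem SchreierSucc_eq (S : Set (Finset ℕ)) : SchreierSucc S = SStar (Schreier 1) S := by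
  ext F
  constructor
  · rintro (rfl | ⟨k, hk, G, h1, h2, h3, h4, rfl⟩)
    · exact SStar_empty (Schreier_empty 1)
    · refine SStar_of_fin (μ := fun i => (G i).min' (h2 i)) h1 h3
        (fun i => ⟨Finset.min'_mem _ _, fun a ha => Finset.min'_le _ _ ha⟩) ?_
      simp only [Schreier, Set.mem_setOf_eq]
      intro a ha
      have hcard : (Finset.image (fun i => (G i).min' (h2 i)) Finset.univ).card ≤ k := by
        simpa using Finset.card_image_le (s := Finset.univ) (f := fun i => (G i).min' (h2 i))
      refine hcard.trans ?_
      obtain ⟨i, -, rfl⟩ := Finset.mem_image.1 ha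
      have hi := Finset.min'_mem (G i) (h2 i)
      have h0 := Finset.min'_mem (G ⟨0, hk⟩) (h2 _)
      by_cases h : i = ⟨0, hk⟩
      · subst h
        exact h4 _ h0
      · have hlt : (⟨0, hk⟩ : Fin k) < i := by
          rw [Fin.lt_def]
          have : i.val ≠ 0 := fun h' => h (Fin.ext h')
          exact Nat.pos_of_ne_zero this
        exact (h4 _ h0).trans (h3 _ _ hlt _ h0 _ hi).le
  · intro h
    rcases F.eq_empty_or_nonempty with rfl | hne
    · exact Or.inl rfl
    · obtain ⟨k, hk, G, μ, h1, h2, h3, h4, h5, h6⟩ := SStar_to_fin h hne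
      refine Or.inr ⟨k, hk, G, h1, h2, h3, ?_, h6⟩
      intro a ha
      have hinj : Function.Injective μ := by
        intro i j hij
        rcases lt_trichotomy i j with h | h | h
        · exact absurd (h3 i j h _ (h4 i).1 _ (h4 j).1) (by omega)
        · exact h
        · exact absurd (h3 j i h _ (h4 j).1 _ (h4 i).1) (by omega)
      simp only [Schreier, Set.mem_setOf_eq] at h5
      have := h5 (μ ⟨0, hk⟩) (Finset.mem_image_of_mem _ (Finset.mem_univ _))
      rw [Finset.card_image_of_injective _ hinj, Finset.card_univ, Fintype.card_fin] at this
      exact this.trans ((h4 _).2 a ha)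

theorem Schreier_one : Schreier 1 = SStar (Schreier 1) (Schreier 0) := by
  ext F
  constructor
  · intro h
    refine ⟨id, by simp [SBlk], ?_, by simpa using h⟩
    intro b hb
    refine Or.inr ⟨b, ?_, ?_⟩
    · simp only [Schreier, Set.mem_setOf_eq] at h
      exact (Finset.card_pos.2 ⟨b, hb⟩).trans_le (h b hb)
    · ext y
      simp only [id, Finset.mem_filter, Finset.mem_singleton]
      exact ⟨fun h => h.2, fun h => ⟨h ▸ hb, h⟩⟩
  · rintro ⟨c, ⟨cm, cF, cle, cid⟩, hB, hA⟩
    have hc : ∀ a ∈ F, c a = a := by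
      intro a ha
      have h1 : a ∈ F.filter (fun x => c x = c a) := by simp [ha]
      have h2 : c a ∈ F.filter (fun x => c x = c a) := by simp [cF a ha, cid a ha]
      rcases hB a ha with h | ⟨n, -, h⟩
      · rw [h] at h1
        simp at h1
      · rw [h, Finset.mem_singleton] at h1 h2
        omega
    have : F.image c = F := by
      rw [Finset.image_congr (g := id) (fun a ha => hc a ha)]
      simp
    rwa [this] at hA

theorem Schreier_succ (n : ℕ) : Schreier (n + 1) = SStar (Schreier 1) (Schreier n) := by
  rcases n with _ | n
  · exact Schreier_one
  · rw [← SchreierSucc_eq]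
    rfl

theorem Schreier_pos (n : ℕ) : ∀ F ∈ Schreier n, ∀ a ∈ F, 0 < a := by
  rcases n with _ | n
  · rintro F (rfl | ⟨n, hn, rfl⟩) a ha
    · simp at ha
    · rw [Finset.mem_singleton] at ha
      omega
  · intro F hF a ha
    rw [Schreier_succ] at hF
    obtain ⟨c, ⟨cm, cF, cle, cid⟩, hB, hA⟩ := hF
    simp only [Schreier, Set.mem_setOf_eq] at hA
    have h1 := Finset.mem_image_of_mem c ha
    have h2 := hA _ h1
    have h3 := Finset.card_pos.2 ⟨_, h1⟩
    have h4 := cle a ha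
    omega

theorem SStar_zero (m : ℕ) : SStar (Schreier 0) (Schreier m) = Schreier m := by
  ext F
  rcases F.eq_empty_or_nonempty with rfl | hne
  · exact iff_of_true (SStar_empty (Schreier_empty 0)) (Schreier_empty m)
  constructor
  · rintro ⟨c, ⟨cm, cF, cle, cid⟩, hB, hA⟩
    obtain ⟨b, hb⟩ := hne
    convert hB b hb using 1
    symm
    apply Finset.filter_true_of_mem
    intro a ha
    have h1 := Finset.mem_image_of_mem c ha
    have h2 := Finset.mem_image_of_mem c hb
    rcases hA with h | ⟨n, -, h⟩
    · rw [h] at h1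
      simp at h1
    · rw [h, Finset.mem_singleton] at h1 h2
      omega
  · intro h
    have hmin := Finset.min'_mem F hne
    refine ⟨fun _ => F.min' hne, ⟨?_, ?_, ?_, ?_⟩, ?_, ?_⟩
    · intros
      exact le_rfl
    · exact fun _ _ => hmin
    · exact fun a ha => Finset.min'_le _ _ ha
    · intros
      rfl
    · intro b hb
      simpa using h
    · exact Or.inr ⟨F.min' hne, Schreier_pos m F h _ hmin, Finset.image_const hne _⟩

/-- For all natural numbers `n, m ≥ 0`, the convolution of Schreier families
satisfies `𝒮ₙ * 𝒮ₘ = 𝒮ₙ₊ₘ`. -/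
theorem schreier_convolution (n m : ℕ) : SchreierConv n m = Schreier (n + m) := by
  rw [SchreierConv_eq]
  induction n with
  | zero => rw [SStar_zero, Nat.zero_add]
  | succ n ih =>
    rw [Schreier_succ n, SStar_assoc, ih, ← Schreier_succ]
    congr 1
    omega
end

section
/- For every infinite subset M of ℕ, every integer n ≥ 1, and every real ε > 0, there exist a finite set F ⊆ M and nonnegative real coefficients (c_k)_{k∈F} such that Σ_{k∈F} c_k e_k is an (n,ε) basic special convex combination. -/
/-- The vector `x = Σ_{k∈F} c_k e_k` is an `(n,ε)` basic special convex combination: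
`F ∈ 𝒮ₙ`, the coefficients `c_k` are nonnegative and sum to `1` over `F`, and every
subset `G ⊆ F` with `G ∈ 𝒮ₙ₋₁` satisfies `Σ_{k∈G} c_k < ε`. -/
def IsBasicSCC (n : ℕ) (ε : ℝ) (F : Finset ℕ) (c : ℕ → ℝ) : Prop :=
  F ∈ Schreier n ∧ (∀ k ∈ F, 0 ≤ c k) ∧ (∑ k ∈ F, c k = 1) ∧
    ∀ G ⊆ F, G ∈ Schreier (n - 1) → ∑ k ∈ G, c k < ε

lemma schreier_cover (n : ℕ) (G : Finset ℕ) (hG : G ∈ Schreier (n + 1)) (a : ℕ) (ha : a ∈ G) :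
    ∃ T : Finset (Finset ℕ), T.card ≤ a ∧ (∀ t ∈ T, t ∈ Schreier n) ∧ G = T.biUnion id := by
  rcases n with _ | n
  · have hG' : ∀ a ∈ G, G.card ≤ a := hG
    refine ⟨G.image (fun x => {x}), Finset.card_image_le.trans (hG' a ha), ?_, ?_⟩
    · intro t ht
      obtain ⟨x, hx, rfl⟩ := Finset.mem_image.1 ht
      refine Or.inr ⟨x, ?_, rfl⟩
      exact lt_of_lt_of_le (Finset.card_pos.2 ⟨x, hx⟩) (hG' x hx)
    · ext x
      simp
  · have hG' : G ∈ SchreierSucc (Schreier (n + 1)) := hG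
    rcases hG' with h | ⟨k, hk, H, hS, hne, hlt, hmin, hU⟩
    · simp [h] at ha
    · refine ⟨Finset.univ.image H, ?_, ?_, ?_⟩
      · refine Finset.card_image_le.trans ?_
        rw [Finset.card_univ, Fintype.card_fin]
        rw [hU] at ha
        obtain ⟨j, _, hj⟩ := Finset.mem_biUnion.1 ha
        by_cases h0 : j = ⟨0, hk⟩
        · exact hmin a (h0 ▸ hj)
        · obtain ⟨b, hb⟩ := hne ⟨0, hk⟩
          have hpos : (⟨0, hk⟩ : Fin k) < j := by
            rw [Fin.lt_def]
            have : j.val ≠ 0 := fun h => h0 (Fin.ext h)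
            simp only
            omega
          exact (hmin b hb).trans (hlt _ j hpos b hb a hj).le
      · intro t ht
        obtain ⟨x, hx, rfl⟩ := Finset.mem_image.1 ht
        exact hS x
      · rw [hU]
        ext x
        simp

lemma sum_cover_le (f : ℕ → ℝ) (hf : ∀ k, 0 ≤ f k) (T : Finset (Finset ℕ)) :
    ∑ k ∈ T.biUnion id, f k ≤ ∑ t ∈ T, ∑ k ∈ t, f k := by
  induction T using Finset.induction_on with
  | empty => simp
  | insert t T ht ih =>
    rw [Finset.biUnion_insert, Finset.sum_insert ht]
    have h := Finset.sum_union_inter (s₁ := t) (s₂ := T.biUnion id) (f := f)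
    have h' : 0 ≤ ∑ k ∈ t ∩ T.biUnion id, f k := Finset.sum_nonneg fun k _ => hf k
    simp only [id] at *
    linarith

lemma scc_strong (n : ℕ) : ∀ (M : Set ℕ), M.Infinite → (∀ m ∈ M, 0 < m) → ∀ ε : ℝ, 0 < ε →
    ∃ (F : Finset ℕ) (c : ℕ → ℝ), ↑F ⊆ M ∧ F ∈ Schreier (n + 1) ∧ (∀ k, 0 ≤ c k) ∧
      (∀ k, k ∉ F → c k = 0) ∧ (∑ k ∈ F, c k = 1) ∧
      ∀ G ∈ Schreier n, ∑ k ∈ G, c k < ε := by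
  induction n with
  | zero =>
    intro M hM hpos ε hε
    obtain ⟨N, hN⟩ := exists_nat_gt (1 / ε)
    have hN0 : (0 : ℝ) < N := lt_trans (by positivity) hN
    have hinf : (M \ ↑(Finset.range N)).Infinite := hM.sdiff (Finset.finite_toSet _)
    obtain ⟨F, hF, hc⟩ := hinf.exists_subset_card_eq N
    have hle : (1 : ℝ) / N < ε := by
      rw [div_lt_iff₀ hN0]
      rw [div_lt_iff₀ hε] at hN
      linarith
    refine ⟨F, fun k => if k ∈ F then 1 / N else 0, fun x hx => (hF hx).1, ?_, ?_, ?_, ?_, ?_⟩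
    · change ∀ a ∈ F, F.card ≤ a
      intro a ha
      have := (hF ha).2
      simp at this
      omega
    · intro k
      dsimp only
      split_ifs <;> positivity
    · intro k hk
      simp [hk]
    · rw [Finset.sum_congr rfl (fun k hk => if_pos hk)]
      simp [hc]
      field_simp
    · rintro G (rfl | ⟨m, hm, rfl⟩)
      · simpa using hε
      · rw [Finset.sum_singleton]
        split_ifs <;> assumption
  | succ n ih =>
    intro M hM hpos ε hε
    have step : ∀ N : ℕ, ∃ (F : Finset ℕ) (c : ℕ → ℝ), (∀ x ∈ F, x ∈ M ∧ N < x) ∧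
        F ∈ Schreier (n + 1) ∧ (∀ k, 0 ≤ c k) ∧
        (∀ k, k ∉ F → c k = 0) ∧ (∑ k ∈ F, c k = 1) ∧
        ∀ G ∈ Schreier n, ∑ k ∈ G, c k < ε / (2 * (N + 1)) := by
      intro N
      have hinf : (M \ ↑(Finset.range (N + 1))).Infinite := hM.sdiff (Finset.finite_toSet _)
      obtain ⟨F, c, h1, h2⟩ := ih _ hinf (fun m hm => hpos m hm.1) (ε / (2 * (N + 1)))
        (by positivity)
      refine ⟨F, c, fun x hx => ⟨(h1 hx).1, ?_⟩, h2⟩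
      have := (h1 hx).2
      simp at this
      omega
    choose Φ C hΦ hS hC0 hCs hC1 hCG using step
    obtain ⟨K, hK⟩ := exists_nat_gt (2 / ε)
    have hK0 : (0 : ℝ) < K := lt_trans (by positivity) hK
    have hKn : 0 < K := by exact_mod_cast hK0
    have hKle : (1 : ℝ) / K < ε / 2 := by
      rw [div_lt_iff₀ hK0]
      rw [div_lt_iff₀ hε] at hK
      linarith
    obtain ⟨N, hN0, hNs⟩ : ∃ N : ℕ → ℕ, N 0 = K ∧ ∀ i, N (i + 1) = (Φ (N i)).sup id :=
      ⟨fun i => Nat.rec K (fun _ m => (Φ m).sup id) i, rfl, fun i => rfl⟩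
    have hle : ∀ i, ∀ x ∈ Φ (N i), x ≤ N (i + 1) := by
      intro i x hx
      rw [hNs]
      exact Finset.le_sup (f := id) hx
    have hne : ∀ m, (Φ m).Nonempty := by
      intro m
      rw [Finset.nonempty_iff_ne_empty]
      intro h
      have := hC1 m
      simp [h] at this
    have hmono : Monotone N := by
      refine monotone_nat_of_le_succ fun i => ?_
      obtain ⟨x, hx⟩ := hne (N i)
      exact (hΦ _ x hx).2.le.trans (hle i x hx)
    have hsum1 : ∀ m (G : Finset ℕ), Φ m ⊆ G → ∑ k ∈ G, C m k = 1 := by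
      intro m G hG
      rw [← hC1 m]
      exact (Finset.sum_subset hG fun x _ hx => hCs m x hx).symm
    have hle1 : ∀ m (G : Finset ℕ), ∑ k ∈ G, C m k ≤ 1 := by
      intro m G
      rw [← hsum1 m (G ∪ Φ m) Finset.subset_union_right]
      exact Finset.sum_le_sum_of_subset_of_nonneg Finset.subset_union_left
        fun x _ _ => hC0 m x
    have hsub : ∀ i : Fin K, Φ (N i) ⊆ Finset.univ.biUnion fun i : Fin K => Φ (N i) :=
      fun i => Finset.subset_biUnion_of_mem (fun i : Fin K => Φ (N i)) (Finset.mem_univ i)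
    refine ⟨Finset.univ.biUnion fun i : Fin K => Φ (N i),
      fun k => (1 / K) * ∑ i : Fin K, C (N i) k, ?_, ?_, ?_, ?_, ?_, ?_⟩
    · intro x hx
      obtain ⟨i, _, hi⟩ := Finset.mem_biUnion.1 (Finset.mem_coe.1 hx)
      exact (hΦ _ x hi).1
    · refine Or.inr ⟨K, hKn, fun i => Φ (N i), fun i => hS _, fun i => hne _, ?_, ?_, rfl⟩
      · intro i j hij a ha b hb
        have h1 : N (i.val + 1) ≤ N j.val := hmono (Nat.succ_le_of_lt (Fin.lt_def.1 hij))
        exact (hle _ a ha).trans_lt (h1.trans_lt (hΦ _ b hb).2)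
      · intro a ha
        have h0 := (hΦ _ a ha).2.le
        exact hN0 ▸ h0
    · intro k
      have : 0 ≤ ∑ i : Fin K, C (N i) k := Finset.sum_nonneg fun i _ => hC0 _ _
      positivity
    · intro k hk
      dsimp only
      rw [Finset.sum_eq_zero, mul_zero]
      intro i _
      exact hCs _ _ fun h => hk (hsub i h)
    · rw [← Finset.mul_sum, Finset.sum_comm,
        Finset.sum_congr rfl (fun (i : Fin K) _ => hsum1 (N i) _ (hsub i))]
      simp
      field_simp
    · intro G hG
      rw [← Finset.mul_sum, Finset.sum_comm]
      by_cases hz : ∃ i, ∑ k ∈ G, C (N i) k ≠ 0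
      · classical
        set i0 := Nat.find hz with hi0
        have hspec : ∑ k ∈ G, C (N i0) k ≠ 0 := Nat.find_spec hz
        obtain ⟨a, haG, ha⟩ := Finset.exists_ne_zero_of_sum_ne_zero hspec
        have haΦ : a ∈ Φ (N i0) := by
          by_contra h
          exact ha (hCs _ _ h)
        obtain ⟨T, hTc, hTS, hTU⟩ := schreier_cover n G hG a haG
        have hbound : ∀ i : ℕ, ∑ k ∈ G, C (N i) k ≤ ε / 2 + if i = i0 then 1 else 0 := by
          intro i
          rcases lt_trichotomy i i0 with h | h | h
          · have : ∑ k ∈ G, C (N i) k = 0 := by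
              by_contra h'
              exact Nat.find_min hz h h'
            rw [this, if_neg h.ne]
            linarith
          · rw [if_pos h]
            have := hle1 (N i) G
            linarith
          · rw [if_neg h.ne', add_zero]
            have haN : a ≤ N i := (hle _ a haΦ).trans (hmono h)
            have hTN : (T.card : ℝ) ≤ N i + 1 := by
              have : T.card ≤ N i + 1 := by omega
              exact_mod_cast this
            have h1 : ∑ k ∈ G, C (N i) k ≤ ∑ t ∈ T, ∑ k ∈ t, C (N i) k := by
              rw [hTU]
              exact sum_cover_le _ (hC0 _) T
            have h2 : ∑ t ∈ T, ∑ k ∈ t, C (N i) k ≤ T.card • (ε / (2 * (N i + 1))) :=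
              Finset.sum_le_card_nsmul _ _ _ fun t ht => (hCG _ t (hTS t ht)).le
            rw [nsmul_eq_mul] at h2
            have h3 : (T.card : ℝ) * (ε / (2 * (N i + 1))) ≤ (N i + 1) * (ε / (2 * (N i + 1))) :=
              mul_le_mul_of_nonneg_right hTN (by positivity)
            have h4 : ((N i : ℝ) + 1) * (ε / (2 * (N i + 1))) = ε / 2 := by
              field_simp
            linarith
        have htot : ∑ i : Fin K, ∑ k ∈ G, C (N i) k ≤ K * (ε / 2) + 1 := by
          rw [Fin.sum_univ_eq_sum_range (fun i => ∑ k ∈ G, C (N i) k) K]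
          refine (Finset.sum_le_sum fun i _ => hbound i).trans ?_
          rw [Finset.sum_add_distrib, Finset.sum_ite_eq']
          simp only [Finset.sum_const, Finset.card_range, nsmul_eq_mul]
          split_ifs <;> linarith
        calc (1 / (K : ℝ)) * ∑ i : Fin K, ∑ k ∈ G, C (N i) k
            ≤ (1 / K) * (K * (ε / 2) + 1) := mul_le_mul_of_nonneg_left htot (by positivity)
          _ = ε / 2 + 1 / K := by field_simp
          _ < ε := by linarith
      · push Not at hz
        rw [Finset.sum_eq_zero fun i _ => hz _]
        simpa using hε

/-- For every infinite subset `M` of the positive integers, every `n ≥ 1` and every `ε > 0`,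
there exist a finite set `F ⊆ M` and nonnegative coefficients `(c_k)_{k∈F}` such that
`Σ_{k∈F} c_k e_k` is an `(n,ε)` basic special convex combination. -/
theorem exists_basic_scc (M : Set ℕ) (hM : M.Infinite) (hMpos : ∀ m ∈ M, 0 < m)
    (n : ℕ) (hn : 1 ≤ n) (ε : ℝ) (hε : 0 < ε) :
    ∃ (F : Finset ℕ) (c : ℕ → ℝ), ↑F ⊆ M ∧ IsBasicSCC n ε F c := by
  obtain ⟨m, rfl⟩ : ∃ m, n = m + 1 := ⟨n - 1, by omega⟩
  obtain ⟨F, c, h1, h2, h3, _, h5, h6⟩ := scc_strong m M hM hMpos ε hε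
  exact ⟨F, c, h1, h2, fun k _ => h3 k, h5, fun G _ hG => h6 G hG⟩
end

section
/- For every f ∈ W_T′ and every integer n ≥ 1, the set {k ∈ ℕ : |f(k)| > 1/2ⁿ} belongs to the Schreier family 𝒮ₙ₋₁. -/
open scoped Classical

/-- A finite sequence `f 0 < f 1 < ⋯ < f (d-1)` of finitely supported vectors is
`𝒮ₙ`-admissible: all supports are nonempty and successive, and the set of minima of the
supports (witnessed by `μ`) belongs to the Schreier family `𝒮ₙ`. -/
def SAdmissible (n : ℕ) {d : ℕ} (f : Fin d → (ℕ →₀ ℝ)) : Prop :=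
  (∀ i, (f i).support.Nonempty) ∧
  (∀ i j : Fin d, i < j → ∀ a ∈ (f i).support, ∀ b ∈ (f j).support, a < b) ∧
  ∃ μ : Fin d → ℕ, (∀ i, μ i ∈ (f i).support ∧ ∀ a ∈ (f i).support, μ i ≤ a) ∧
    Finset.image μ Finset.univ ∈ Schreier n

/-- The restriction `Ef` of a finitely supported vector `f` to a set `E ⊆ ℕ`:
`(Ef)(k) = f(k)` for `k ∈ E` and `0` otherwise. -/
noncomputable def restrictTo (E : Set ℕ) (f : ℕ →₀ ℝ) : ℕ →₀ ℝ :=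
  Finsupp.filter (· ∈ E) f

/-- The Tsirelson norming set `W_T′`: the smallest subset of `c₀₀` containing `±eₙ` for every
positive integer `n`, closed under restrictions to subsets of `ℕ`, and such that for every
`𝒮₁`-admissible sequence `f₁ < ⋯ < f_d` in `W_T′` the functional `(1/2)(f₁ + ⋯ + f_d)`
belongs to `W_T′`. -/
inductive TsirelsonW : (ℕ →₀ ℝ) → Prop
  | unit_pos (n : ℕ) (hn : 0 < n) : TsirelsonW (Finsupp.single n 1)
  | unit_neg (n : ℕ) (hn : 0 < n) : TsirelsonW (-Finsupp.single n 1)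
  | restrict (E : Set ℕ) (f : ℕ →₀ ℝ) (hf : TsirelsonW f) : TsirelsonW (restrictTo E f)
  | node (d : ℕ) (hd : 0 < d) (f : Fin d → (ℕ →₀ ℝ)) (hf : ∀ i, TsirelsonW (f i))
      (hadm : SAdmissible 1 f) : TsirelsonW ((1 / 2 : ℝ) • ∑ i, f i)

theorem schreier_empty (n : ℕ) : (∅ : Finset ℕ) ∈ Schreier n := by
  match n with
  | 0 => exact Or.inl rfl
  | 1 => intro a ha; simp at ha
  | n + 2 => exact Or.inl rfl

theorem schreier_union (n d : ℕ) (A : Fin d → Finset ℕ) (hA : ∀ i, A i ∈ Schreier n)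
    (hs : ∀ i j : Fin d, i < j → ∀ a ∈ A i, ∀ b ∈ A j, a < b)
    (hd : ∀ i, ∀ a ∈ A i, d ≤ a) : Finset.univ.biUnion A ∈ Schreier (n + 1) := by
  match n, hA with
  | 0, hA =>
    intro a ha
    have h1 : (Finset.univ.biUnion A).card ≤ d := by
      refine Finset.card_biUnion_le.trans ?_
      calc ∑ i, (A i).card ≤ ∑ i : Fin d, 1 := by
            apply Finset.sum_le_sum
            intro i _
            rcases hA i with h | ⟨m, _, h⟩ <;> simp [h]
        _ = d := by simp
    obtain ⟨i, _, hi⟩ := Finset.mem_biUnion.1 ha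
    exact h1.trans (hd i a hi)
  | n + 1, hA =>
    by_cases hs0 : 0 < (Finset.univ.filter fun i => (A i).Nonempty).card
    · right
      set s := Finset.univ.filter fun i => (A i).Nonempty with hsdef
      refine ⟨s.card, hs0, fun j => A (s.orderEmbOfFin rfl j), fun j => hA _, ?_, ?_, ?_, ?_⟩
      · intro j
        have := s.orderEmbOfFin_mem rfl j
        exact (Finset.mem_filter.1 this).2
      · intro i j hij
        exact hs _ _ ((s.orderEmbOfFin rfl).strictMono hij)
      · intro a ha
        refine le_trans ?_ (hd _ a ha)
        simpa using s.card_le_univ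
      · ext a
        simp only [Finset.mem_biUnion, Finset.mem_univ, true_and]
        constructor
        · rintro ⟨i, hi⟩
          have his : i ∈ s := by
            rw [hsdef, Finset.mem_filter]
            exact ⟨Finset.mem_univ _, a, hi⟩
          have : i ∈ Set.range (s.orderEmbOfFin rfl) := by
            rw [Finset.range_orderEmbOfFin]; exact his
          obtain ⟨j, rfl⟩ := this
          exact ⟨j, hi⟩
        · rintro ⟨j, hj⟩
          exact ⟨_, hj⟩
    · left
      have h0 : (Finset.univ.filter fun i => (A i).Nonempty) = ∅ := by
        rw [← Finset.card_eq_zero]; omega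
      ext a
      simp only [Finset.mem_biUnion, Finset.mem_univ, true_and, Finset.notMem_empty, iff_false]
      rintro ⟨i, hi⟩
      have : i ∈ (Finset.univ.filter fun i => (A i).Nonempty) :=
        Finset.mem_filter.2 ⟨Finset.mem_univ _, a, hi⟩
      rw [h0] at this
      simp at this

theorem schreier_mono (n : ℕ) : ∀ F ∈ Schreier n, ∀ G ⊆ F, G ∈ Schreier n := by
  induction n with
  | zero =>
    rintro F (rfl | ⟨m, hm, rfl⟩) G hG
    · left; exact Finset.subset_empty.1 hG
    · rcases Finset.subset_singleton_iff.1 hG with h | h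
      · exact Or.inl h
      · exact Or.inr ⟨m, hm, h⟩
  | succ n ih =>
    match n, ih with
    | 0, _ =>
      intro F hF G hG a ha
      exact (Finset.card_le_card hG).trans (hF a (hG ha))
    | n + 1, ih =>
      rintro F (rfl | ⟨k, hk, A, hA, hne, hs, h0, rfl⟩) G hG
      · left; exact Finset.subset_empty.1 hG
      · have hGe : G = Finset.univ.biUnion fun i => A i ∩ G := by
          ext a
          simp only [Finset.mem_biUnion, Finset.mem_univ, true_and, Finset.mem_inter]
          constructor
          · intro ha
            obtain ⟨i, _, hi⟩ := Finset.mem_biUnion.1 (hG ha)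
            exact ⟨i, hi, ha⟩
          · rintro ⟨i, _, ha⟩
            exact ha
        rw [hGe]
        apply schreier_union
        · intro i
          exact ih _ (hA i) _ Finset.inter_subset_left
        · intro i j hij a ha b hb
          exact hs i j hij a (Finset.mem_inter.1 ha).1 b (Finset.mem_inter.1 hb).1
        · intro i a ha
          have ha := (Finset.mem_inter.1 ha).1
          by_cases hi : i = ⟨0, hk⟩
          · subst hi; exact h0 a ha
          · obtain ⟨b, hb⟩ := hne ⟨0, hk⟩
            have hlt : (⟨0, hk⟩ : Fin k) < i := by
              rw [Fin.lt_def]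
              rcases Nat.eq_zero_or_pos i.val with h | h
              · exact absurd (Fin.ext h) hi
              · exact h
            exact (h0 b hb).trans (hs _ _ hlt b hb a ha).le

theorem schreier_singleton (n m : ℕ) (hm : 0 < m) : ({m} : Finset ℕ) ∈ Schreier n := by
  induction n with
  | zero => exact Or.inr ⟨m, hm, rfl⟩
  | succ n ih =>
    have := schreier_union n 1 (fun _ => {m}) (fun _ => ih)
      (fun i j hij => absurd hij (by omega)) (by simpa using Nat.succ_le_of_lt hm)
    simpa using this

theorem node_value {d : ℕ} (f : Fin d → (ℕ →₀ ℝ)) (hadm : SAdmissible 1 f) (k : ℕ)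
    (hk : ((1 / 2 : ℝ) • ∑ i, f i) k ≠ 0) :
    ∃ i, f i k ≠ 0 ∧ |((1 / 2 : ℝ) • ∑ i, f i) k| = 1 / 2 * |f i k| := by
  have hv : ((1 / 2 : ℝ) • ∑ i, f i) k = 1 / 2 * ∑ i, f i k := by
    simp
  have hne : ∑ i, f i k ≠ 0 := by
    intro h; rw [hv, h] at hk; simp at hk
  obtain ⟨i, _, hi⟩ := Finset.exists_ne_zero_of_sum_ne_zero hne
  refine ⟨i, hi, ?_⟩
  have : ∑ j, f j k = f i k := by
    apply Finset.sum_eq_single i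
    · intro j _ hji
      by_contra hj
      rcases lt_or_gt_of_ne hji with h | h
      · exact lt_irrefl _ (hadm.2.1 _ _ h k (by simpa using hj) k (by simpa using hi))
      · exact lt_irrefl _ (hadm.2.1 _ _ h k (by simpa using hi) k (by simpa using hj))
    · simp
  rw [hv, this, abs_mul]
  norm_num

theorem tsirelsonW_abs_le (f : ℕ →₀ ℝ) (hf : TsirelsonW f) (k : ℕ) : |f k| ≤ 1 := by
  induction hf with
  | unit_pos n hn => rw [Finsupp.single_apply]; split_ifs <;> simp
  | unit_neg n hn => rw [Finsupp.neg_apply, Finsupp.single_apply]; split_ifs <;> simp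
  | restrict E f hf ih =>
    rw [restrictTo, Finsupp.filter_apply]
    split_ifs
    · exact ih
    · simp
  | node d hd f hf hadm ih =>
    by_cases hk : ((1 / 2 : ℝ) • ∑ i, f i) k = 0
    · rw [hk]; simp
    · obtain ⟨i, _, hi⟩ := node_value f hadm k hk
      rw [hi]
      linarith [ih i, abs_nonneg (f i k)]

theorem admissible_card_le {d : ℕ} (f : Fin d → (ℕ →₀ ℝ)) (hadm : SAdmissible 1 f)
    (i : Fin d) (a : ℕ) (ha : a ∈ (f i).support) : d ≤ a := by
  obtain ⟨_, h2, μ, hμ, hS⟩ := hadm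
  have hinj : StrictMono μ := fun i j hij => h2 i j hij _ (hμ i).1 _ (hμ j).1
  have h := hS (μ i) (Finset.mem_image_of_mem _ (Finset.mem_univ i))
  rw [Finset.card_image_of_injective _ hinj.injective] at h
  simp only [Finset.card_univ, Fintype.card_fin] at h
  exact h.trans ((hμ i).2 a ha)

theorem tsirelsonW_aux (f : ℕ →₀ ℝ) (hf : TsirelsonW f) :
    ∀ n : ℕ, (f.support.filter fun k => 1 / 2 ^ (n + 1) < |f k|) ∈ Schreier n := by
  induction hf with
  | unit_pos m hm =>
    intro n
    refine schreier_mono n _ (schreier_singleton n m hm) _ ?_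
    exact (Finset.filter_subset _ _).trans Finsupp.support_single_subset
  | unit_neg m hm =>
    intro n
    refine schreier_mono n _ (schreier_singleton n m hm) _ ?_
    refine (Finset.filter_subset _ _).trans ?_
    rw [Finsupp.support_neg]
    exact Finsupp.support_single_subset
  | restrict E f hf ih =>
    intro n
    refine schreier_mono n _ (ih n) _ ?_
    intro a ha
    rw [Finset.mem_filter, Finsupp.mem_support_iff, restrictTo, Finsupp.filter_apply] at ha
    rw [Finset.mem_filter, Finsupp.mem_support_iff]
    split_ifs at ha
    · exact ha
    · exact absurd rfl ha.1
  | node d hd f hf hadm ih =>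
    intro n
    match n with
    | 0 =>
      refine schreier_mono 0 _ (schreier_empty 0) _ ?_
      intro k hk
      rw [Finset.mem_filter, Finsupp.mem_support_iff] at hk
      obtain ⟨i, _, hi⟩ := node_value f hadm k hk.1
      have h1 := tsirelsonW_abs_le _ (hf i) k
      have h2 := hk.2
      rw [hi] at h2
      norm_num at h2
      linarith
    | n + 1 =>
      refine schreier_mono (n + 1) _ (schreier_union n d
        (fun i => (f i).support.filter fun k => 1 / 2 ^ (n + 1) < |f i k|)
        (fun i => ih i n) ?_ ?_) _ ?_
      · intro i j hij a ha b hb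
        exact hadm.2.1 i j hij a (Finset.mem_filter.1 ha).1 b (Finset.mem_filter.1 hb).1
      · intro i a ha
        exact admissible_card_le f hadm i a (Finset.mem_filter.1 ha).1
      · intro k hk
        rw [Finset.mem_filter, Finsupp.mem_support_iff] at hk
        obtain ⟨i, hne, hi⟩ := node_value f hadm k hk.1
        have h2 := hk.2
        rw [hi] at h2
        rw [Finset.mem_biUnion]
        refine ⟨i, Finset.mem_univ _, Finset.mem_filter.2 ⟨Finsupp.mem_support_iff.2 hne, ?_⟩⟩
        have h3 : (1 : ℝ) / 2 ^ (n + 1 + 1) = 1 / 2 * (1 / 2 ^ (n + 1)) := by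
          rw [pow_succ (2 : ℝ) (n + 1)]; field_simp
        rw [h3] at h2
        linarith

/-- For every `f ∈ W_T′` and every integer `n ≥ 1`, the set `{k : |f(k)| > 1/2ⁿ}` belongs
to the Schreier family `𝒮ₙ₋₁`. -/
theorem tsirelsonW_large_coords_schreier (f : ℕ →₀ ℝ) (hf : TsirelsonW f)
    (n : ℕ) (hn : 1 ≤ n) :
    (f.support.filter fun k => 1 / 2 ^ n < |f k|) ∈ Schreier (n - 1) := by
  obtain ⟨m, rfl⟩ : ∃ m, n = m + 1 := ⟨n - 1, by omega⟩
  exact tsirelsonW_aux f hf m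
end

section
/- For every integer n ≥ 1 and every 𝒮ₙ-admissible finite sequence f₁ < ⋯ < f_d of elements of W_T′, the functional (1/2ⁿ)(f₁ + ⋯ + f_d) belongs to W_T′; that is, the Tsirelson norming set is closed under the (1/2ⁿ, 𝒮ₙ) operations. -/
open scoped Classical

/-- Version of admissibility indexed by the minima of the supports. -/
def GoodFam (s : Finset ℕ) (F : ℕ → (ℕ →₀ ℝ)) : Prop :=
  (∀ a ∈ s, TsirelsonW (F a)) ∧ (∀ a ∈ s, a ∈ (F a).support) ∧
  (∀ a ∈ s, ∀ x ∈ (F a).support, a ≤ x) ∧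
  (∀ a ∈ s, ∀ b ∈ s, a < b → ∀ x ∈ (F a).support, ∀ y ∈ (F b).support, x < y)

theorem GoodFam.mono {s t : Finset ℕ} {F : ℕ → (ℕ →₀ ℝ)} (h : GoodFam s F) (hts : t ⊆ s) :
    GoodFam t F :=
  ⟨fun a ha => h.1 a (hts ha), fun a ha => h.2.1 a (hts ha), fun a ha => h.2.2.1 a (hts ha),
    fun a ha b hb => h.2.2.2 a (hts ha) b (hts hb)⟩

theorem mem_support_smul_sum {t : Finset ℕ} {F : ℕ → (ℕ →₀ ℝ)} {c : ℝ} {x : ℕ}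
    (hx : x ∈ (c • ∑ a ∈ t, F a).support) : ∃ a ∈ t, x ∈ (F a).support := by
  by_contra hcon
  push Not at hcon
  rw [Finsupp.mem_support_iff] at hx
  apply hx
  rw [Finsupp.smul_apply, Finsupp.finset_sum_apply, Finset.sum_eq_zero, smul_zero]
  intro a ha
  exact Finsupp.notMem_support_iff.mp (hcon a ha)

theorem good_closed (n : ℕ) : ∀ (s : Finset ℕ) (F : ℕ → (ℕ →₀ ℝ)), s.Nonempty →
    s ∈ Schreier (n + 1) → GoodFam s F →
    TsirelsonW ((1 / 2 ^ (n + 1) : ℝ) • ∑ a ∈ s, F a) := by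
  induction n with
  | zero =>
    intro s F hs hS hF
    have hmem : ∀ i, s.orderEmbOfFin rfl i ∈ s := fun i => s.orderEmbOfFin_mem rfl i
    have himg : Finset.image (s.orderEmbOfFin rfl) Finset.univ = s := by
      apply Finset.coe_injective
      simp
    have key := TsirelsonW.node s.card hs.card_pos (fun i => F (s.orderEmbOfFin rfl i))
      (fun i => hF.1 _ (hmem i))
      ⟨fun i => ⟨_, hF.2.1 _ (hmem i)⟩,
       fun i j hij => hF.2.2.2 _ (hmem i) _ (hmem j) ((s.orderEmbOfFin rfl).strictMono hij),
       s.orderEmbOfFin rfl, fun i => ⟨hF.2.1 _ (hmem i), hF.2.2.1 _ (hmem i)⟩, by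
        rw [himg]; exact hS⟩
    have hsum : ∑ a ∈ s, F a = ∑ i, F (s.orderEmbOfFin rfl i) := by
      conv_lhs => rw [← himg]
      exact Finset.sum_image (fun x _ y _ h => (s.orderEmbOfFin rfl).injective h)
    rw [hsum]
    simpa using key
  | succ n ih =>
    intro s F hs hS hF
    have hS' : s ∈ SchreierSucc (Schreier (n + 1)) := hS
    rcases hS' with h0 | ⟨k, hk, G, hGS, hGne, hGlt, hGk, hsG⟩
    · exact absurd h0 hs.ne_empty
    have hsub : ∀ j, G j ⊆ s := by
      intro j
      rw [hsG]
      exact Finset.subset_biUnion_of_mem G (Finset.mem_univ j)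
    have hmin : ∀ j, (G j).min' (hGne j) ∈ G j := fun j => Finset.min'_mem _ _
    have hsupp : ∀ j, (G j).min' (hGne j) ∈
        ((1 / 2 ^ (n + 1) : ℝ) • ∑ a ∈ G j, F a).support := by
      intro j
      rw [Finsupp.mem_support_iff, Finsupp.smul_apply, Finsupp.finset_sum_apply,
        Finset.sum_eq_single ((G j).min' (hGne j))]
      · have := Finsupp.mem_support_iff.mp (hF.2.1 _ (hsub j (hmin j)))
        exact smul_ne_zero (by positivity) this
      · intro b hb hne
        by_contra hcon
        have h1 := hF.2.2.1 b (hsub j hb) _ (Finsupp.mem_support_iff.mpr hcon)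
        have h2 := (G j).min'_le b hb
        omega
      · intro h; exact absurd (hmin j) h
    have key := TsirelsonW.node k hk
      (fun j => (1 / 2 ^ (n + 1) : ℝ) • ∑ a ∈ G j, F a)
      (fun j => ih (G j) F (hGne j) (hGS j) (hF.mono (hsub j)))
      ⟨fun j => ⟨_, hsupp j⟩, by
        intro i j hij x hx y hy
        obtain ⟨a, ha, hxa⟩ := mem_support_smul_sum hx
        obtain ⟨b, hb, hyb⟩ := mem_support_smul_sum hy
        exact hF.2.2.2 a (hsub i ha) b (hsub j hb) (hGlt i j hij a ha b hb) x hxa y hyb,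
       fun j => (G j).min' (hGne j), by
        intro j
        refine ⟨hsupp j, fun x hx => ?_⟩
        obtain ⟨a, ha, hxa⟩ := mem_support_smul_sum hx
        exact ((G j).min'_le a ha).trans (hF.2.2.1 a (hsub j ha) x hxa), by
        intro a ha
        obtain ⟨j, -, rfl⟩ := Finset.mem_image.mp ha
        have hcard : (Finset.image (fun j => (G j).min' (hGne j)) Finset.univ).card ≤ k := by
          simpa using Finset.card_image_le (s := (Finset.univ : Finset (Fin k)))
            (f := fun j => (G j).min' (hGne j))
        refine hcard.trans ?_
        have h0 := hGk _ (hmin ⟨0, hk⟩)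
        rcases Nat.eq_zero_or_pos j.1 with hj | hj
        · have : j = ⟨0, hk⟩ := Fin.ext hj
          subst this
          exact h0
        · exact h0.trans (hGlt ⟨0, hk⟩ j hj _ (hmin _) _ (hmin j)).le⟩
    have hsum : ∑ a ∈ s, F a = ∑ j, ∑ a ∈ G j, F a := by
      rw [hsG, Finset.sum_biUnion]
      intro i _ j _ hij
      rw [Function.onFun, Finset.disjoint_left]
      intro a hai haj
      rcases lt_or_gt_of_ne hij with h | h
      · exact lt_irrefl _ (hGlt i j h a hai a haj)
      · exact lt_irrefl _ (hGlt j i h a haj a hai)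
    rw [hsum]
    rw [← Finset.smul_sum, smul_smul] at key
    convert key using 2
    rw [pow_succ]
    field_simp

/-- For every integer `n ≥ 1` and every `𝒮ₙ`-admissible finite sequence `f₁ < ⋯ < f_d` of
elements of `W_T′`, the functional `(1/2ⁿ)(f₁ + ⋯ + f_d)` belongs to `W_T′`; that is, the
Tsirelson norming set is closed under the `(1/2ⁿ, 𝒮ₙ)` operations. -/
theorem tsirelsonW_closed_under_schreier_ops (n : ℕ) (hn : 1 ≤ n)
    (d : ℕ) (hd : 0 < d) (f : Fin d → (ℕ →₀ ℝ)) (hf : ∀ i, TsirelsonW (f i))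
    (hadm : SAdmissible n f) :
    TsirelsonW ((1 / 2 ^ n : ℝ) • ∑ i, f i) := by
  obtain ⟨m, rfl⟩ : ∃ m, n = m + 1 := ⟨n - 1, by omega⟩
  obtain ⟨-, hlt, μ, hμ, hS⟩ := hadm
  have hμlt : ∀ i j, i < j → μ i < μ j := fun i j hij =>
    hlt i j hij _ (hμ i).1 _ (hμ j).1
  have hmono : StrictMono μ := fun i j hij => hμlt i j hij
  have hext : ∀ i, Function.extend μ f 0 (μ i) = f i := fun i =>
    hmono.injective.extend_apply f 0 i
  have key := good_closed m (Finset.image μ Finset.univ) (Function.extend μ f 0)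
    ⟨μ ⟨0, hd⟩, Finset.mem_image_of_mem _ (Finset.mem_univ _)⟩ hS (by
      refine ⟨?_, ?_, ?_, ?_⟩
      · intro a ha
        obtain ⟨i, -, rfl⟩ := Finset.mem_image.mp ha
        rw [hext]; exact hf i
      · intro a ha
        obtain ⟨i, -, rfl⟩ := Finset.mem_image.mp ha
        rw [hext]; exact (hμ i).1
      · intro a ha
        obtain ⟨i, -, rfl⟩ := Finset.mem_image.mp ha
        rw [hext]; exact (hμ i).2
      · intro a ha b hb hab
        obtain ⟨i, -, rfl⟩ := Finset.mem_image.mp ha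
        obtain ⟨j, -, rfl⟩ := Finset.mem_image.mp hb
        rw [hext, hext]; exact hlt i j (hmono.lt_iff_lt.mp hab))
  rw [Finset.sum_image (fun x _ y _ h => hmono.injective h)] at key
  simpa only [hext] using key
end

section
/- Let n ≥ 1, ε > 0, m ≥ 1, and let ψ(1) ≤ φ(1) < ψ(2) ≤ φ(2) < ⋯ < ψ(m) ≤ φ(m) be positive integers. If Σ_{k=1}^m c_k e_{ψ(k)} is an (n,ε) basic special convex combination, then Σ_{k=1}^m c_k e_{φ(k)} is an (n,2ε) basic special convex combination. -/
theorem schreier_spread {ι : Type*} [LinearOrder ι] (a b : ι → ℕ) (ha : StrictMono a)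
    (hb : StrictMono b) (hab : ∀ i, a i ≤ b i) (n : ℕ) :
    ∀ (F : Finset ℕ) (J : Finset ι), F ∈ Schreier n → (∀ i ∈ J, a i ∈ F) →
      J.image b ∈ Schreier n := by
  have hcard : ∀ (F : Finset ℕ) (J : Finset ι), (∀ i ∈ J, a i ∈ F) →
      (J.image b).card ≤ F.card := by
    intro F J h
    refine Finset.card_image_le.trans ?_
    exact Finset.card_le_card_of_injOn a h ha.injective.injOn
  induction n using Nat.strong_induction_on with
  | _ n ih =>
  match n, ih with
  | 0, _ =>
    intro F J hF hJ
    rcases J.eq_empty_or_nonempty with rfl | ⟨i, hi⟩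
    · left; simp
    · right
      rcases hF with rfl | ⟨p, hp, rfl⟩
      · exact absurd (hJ i hi) (by simp)
      · refine ⟨b i, ?_, ?_⟩
        · have h1 := hJ i hi
          have h2 := hab i
          simp at h1
          omega
        · have : J = {i} := by
            ext j
            constructor
            · intro hj
              have h1 := hJ i hi
              have h2 := hJ j hj
              simp at h1 h2 ⊢
              exact ha.injective (h2.trans h1.symm)
            · intro hj
              simp at hj
              exact hj ▸ hi
          rw [this]; simp
  | 1, _ =>
    intro F J hF hJ x hx
    obtain ⟨i, hi, rfl⟩ := Finset.mem_image.1 hx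
    exact (hcard F J hJ).trans ((hF _ (hJ i hi)).trans (hab i))
  | n + 2, ih =>
    intro F J hF hJ
    rcases J.eq_empty_or_nonempty with rfl | ⟨i₀, hi₀⟩
    · left; simp
    right
    rcases hF with rfl | ⟨k, hk, G, hGS, hGne, hGlt, hGmin, rfl⟩
    · exact absurd (hJ i₀ hi₀) (by simp)
    have hmem : ∀ i ∈ J, ∃ t, a i ∈ G t := by
      intro i hi
      simpa using hJ i hi
    have hkle : ∀ t, ∀ x ∈ G t, k ≤ x := by
      intro t x hx
      by_cases h0 : t = ⟨0, hk⟩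
      · subst h0; exact hGmin x hx
      · obtain ⟨y, hy⟩ := hGne ⟨0, hk⟩
        have h1 := hGmin y hy
        have h2 : (⟨0, hk⟩ : Fin k) < t := by
          rw [Fin.lt_def]
          have : t.val ≠ 0 := fun h => h0 (Fin.ext h)
          simp only; omega
        have := hGlt _ _ h2 y hy x hx
        omega
    let P : Fin k → Finset ι := fun t => J.filter (fun i => a i ∈ G t)
    let T : Finset (Fin k) := Finset.univ.filter (fun t => (P t).Nonempty)
    have hTk : T.card ≤ k := by simpa using Finset.card_le_univ T
    have hT0 : 0 < T.card := by
      obtain ⟨t, ht⟩ := hmem i₀ hi₀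
      refine Finset.card_pos.2 ⟨t, ?_⟩
      simp only [T, P, Finset.mem_filter, Finset.mem_univ, true_and]
      exact ⟨i₀, by simp [hi₀, ht]⟩
    let e := T.orderEmbOfFin rfl
    refine ⟨T.card, hT0, fun s => (P (e s)).image b, ?_, ?_, ?_, ?_, ?_⟩
    · intro s
      exact ih (n + 1) (by omega) (G (e s)) _ (hGS _) (fun i hi => (Finset.mem_filter.1 hi).2)
    · intro s
      have := Finset.orderEmbOfFin_mem T rfl s
      exact ((Finset.mem_filter.1 this).2).image b
    · intro s t hst x hx y hy
      obtain ⟨i, hi, rfl⟩ := Finset.mem_image.1 hx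
      obtain ⟨j, hj, rfl⟩ := Finset.mem_image.1 hy
      have := hGlt (e s) (e t) (e.strictMono hst) _ (Finset.mem_filter.1 hi).2 _
        (Finset.mem_filter.1 hj).2
      exact hb (ha.lt_iff_lt.1 this)
    · intro x hx
      obtain ⟨i, hi, rfl⟩ := Finset.mem_image.1 hx
      exact hTk.trans ((hkle _ _ (Finset.mem_filter.1 hi).2).trans (hab i))
    · ext x
      simp only [Finset.mem_image, Finset.mem_biUnion, Finset.mem_univ, true_and]
      constructor
      · rintro ⟨i, hi, rfl⟩
        obtain ⟨t, ht⟩ := hmem i hi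
        have hiP : i ∈ P t := Finset.mem_filter.2 ⟨hi, ht⟩
        have htT : t ∈ T := Finset.mem_filter.2 ⟨Finset.mem_univ _, ⟨i, hiP⟩⟩
        have : t ∈ Set.range e := by
          rw [Finset.range_orderEmbOfFin]; exact htT
        obtain ⟨s, rfl⟩ := this
        exact ⟨s, i, hiP, rfl⟩
      · rintro ⟨s, i, hi, rfl⟩
        exact ⟨i, (Finset.mem_filter.1 hi).1, rfl⟩

theorem schreier_singleton_s5 (x : ℕ) (hx : 0 < x) (n : ℕ) : {x} ∈ Schreier n := by
  induction n using Nat.strong_induction_on with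
  | _ n ih =>
  match n, ih with
  | 0, _ => exact Or.inr ⟨x, hx, rfl⟩
  | 1, _ =>
    intro y hy
    simp at hy ⊢
    omega
  | n + 2, ih =>
    right
    refine ⟨1, one_pos, fun _ => {x}, fun _ => ih (n + 1) (by omega), by simp, ?_, ?_, ?_⟩
    · intro i j hij
      exact absurd hij (by simp [Subsingleton.elim i j])
    · intro y hy
      simp at hy
      omega
    · ext y; simp

/-- Let `n ≥ 1`, `ε > 0`, `m ≥ 1` and let `ψ(1) ≤ φ(1) < ψ(2) ≤ φ(2) < ⋯ < ψ(m) ≤ φ(m)` be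
positive integers.  If `Σ_{k=1}^m c_k e_{ψ(k)}` is an `(n,ε)` basic special convex
combination, then `Σ_{k=1}^m c_k e_{φ(k)}` is an `(n,2ε)` basic special convex combination.
(The coefficient functions `cψ, cφ : ℕ → ℝ` realize the coefficients `c` on the
supports `ψ` and `φ` respectively.) -/
theorem basic_scc_shift (n : ℕ) (hn : 1 ≤ n) (ε : ℝ) (hε : 0 < ε) (m : ℕ) (hm : 1 ≤ m)
    (ψ φ : Fin m → ℕ) (hψpos : ∀ i, 0 < ψ i) (hφpos : ∀ i, 0 < φ i)
    (hle : ∀ i, ψ i ≤ φ i) (hlt : ∀ i j : Fin m, i < j → φ i < ψ j)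
    (c : Fin m → ℝ) (cψ cφ : ℕ → ℝ)
    (hcψ : ∀ i, cψ (ψ i) = c i) (hcφ : ∀ i, cφ (φ i) = c i)
    (hscc : IsBasicSCC n ε (Finset.image ψ Finset.univ) cψ) :
    IsBasicSCC n (2 * ε) (Finset.image φ Finset.univ) cφ := by
  have hψm : StrictMono ψ := fun i j h => (hle i).trans_lt (hlt i j h)
  have hφm : StrictMono φ := fun i j h => (hlt i j h).trans_le (hle j)
  obtain ⟨h1, h2, h3, h4⟩ := hscc
  refine ⟨?_, ?_, ?_, ?_⟩
  · exact schreier_spread ψ φ hψm hφm hle n _ Finset.univ h1 (by simp)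
  · intro k hk
    obtain ⟨i, -, rfl⟩ := Finset.mem_image.1 hk
    rw [hcφ, ← hcψ]
    exact h2 _ (by simp)
  · rw [Finset.sum_image hφm.injective.injOn]
    rw [Finset.sum_image hψm.injective.injOn] at h3
    simpa only [hcφ, hcψ] using h3
  · intro G hG hGS
    obtain ⟨I, -, rfl⟩ := Finset.subset_image_iff.1 hG
    rw [Finset.sum_image hφm.injective.injOn]
    simp only [hcφ]
    rcases hI : I.card with _ | s
    · rw [Finset.card_eq_zero] at hI
      subst hI
      simpa using hε
    let e := I.orderEmbOfFin hI
    have hsum : ∑ i ∈ I, c i = ∑ j, c (e j) := by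
      have : I = Finset.univ.image e := (Finset.image_orderEmbOfFin_univ I hI).symm
      conv_lhs => rw [this]
      rw [Finset.sum_image e.injective.injOn]
    rw [hsum, Fin.sum_univ_succ]
    have hA : c (e 0) < ε := by
      have := h4 {ψ (e 0)} (by simp) (schreier_singleton_s5 _ (hψpos _) _)
      simpa [hcψ] using this
    have hbm : StrictMono (fun j : Fin s => ψ (e j.succ)) :=
      fun i j h => hψm (e.strictMono (Fin.succ_lt_succ_iff.2 h))
    have hB : ∑ j : Fin s, c (e j.succ) < ε := by
      have hS := schreier_spread (fun j : Fin s => φ (e j.castSucc)) (fun j => ψ (e j.succ))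
        (fun i j h => hφm (e.strictMono (Fin.castSucc_lt_castSucc_iff.2 h))) hbm
        (fun j => (hlt _ _ (e.strictMono (Fin.castSucc_lt_succ))).le) (n - 1) _ Finset.univ hGS
        (fun j _ => Finset.mem_image_of_mem _ (Finset.orderEmbOfFin_mem I hI _))
      have := h4 _ (by
        intro x hx
        obtain ⟨j, -, rfl⟩ := Finset.mem_image.1 hx
        simp) hS
      rw [Finset.sum_image hbm.injective.injOn] at this
      simpa only [hcψ] using this
    linarith
end
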